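/- arXiv:2602.12780 — 5 statements merged into one kernel-verified Lean document; each statement's English description precedes it below -/
import Mathlib

section
/- Let (d_1, …, d_n) be a non-increasing sequence of positive integers with n ≥ 2 and d_1 ≤ n − 1. Then (d_1, …, d_n) is graphic if and only if the sequence consisting of the entries d_2 − 1, d_3 − 1, …, d_n − 1 together with n − 1 − d_1 additional entries equal to 1 is graphic. -/
/-- The multiset of vertex degrees of a finite simple graph. -/
noncomputable def degreeMultiset {V : Type*} [Fintype V] (G : SimpleGraph V) : Multiset ℕ :=
  Finset.univ.val.map fun v => (G.neighborSet v).ncard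

/-- A multiset of natural numbers is graphic if it is the degree multiset of some
finite simple graph. -/
def IsGraphic (D : Multiset ℕ) : Prop :=
  ∃ (V : Type) (_ : Fintype V) (G : SimpleGraph V), degreeMultiset G = D

namespace SimpleGraph

variable {V W : Type*}

theorem ncard_neighborSet_comap_add [Finite W] (G : SimpleGraph W) {f : V → W}
    (hf : Function.Injective f) (a : V) :
    (G.neighborSet (f a)).ncard =
      ((G.comap f).neighborSet a).ncard + (G.neighborSet (f a) \ Set.range f).ncard := by
  rw [← Set.ncard_inter_add_ncard_sdiff_eq_ncard (G.neighborSet (f a)) (Set.range f)]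
  congr 1
  rw [← Set.ncard_image_of_injective _ hf]
  congr 1
  ext w
  simp only [Set.mem_inter_iff, mem_neighborSet, Set.mem_range, Set.mem_image, comap_adj]
  constructor
  · rintro ⟨h, y, rfl⟩
    exact ⟨y, h, rfl⟩
  · rintro ⟨y, h, rfl⟩
    exact ⟨h, y, rfl⟩

theorem ncard_neighborSet_comap [Finite W] (G : SimpleGraph W) {f : V → W}
    (hf : Function.Injective f) (a : V) (h : G.neighborSet (f a) ⊆ Set.range f) :
    ((G.comap f).neighborSet a).ncard = (G.neighborSet (f a)).ncard := by
  rw [G.ncard_neighborSet_comap_add hf, Set.sdiff_eq_empty.2 h, Set.ncard_empty, add_zero]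

theorem ncard_neighborSet_map (G : SimpleGraph V) (f : V ↪ W) (a : V) :
    ((G.map f).neighborSet (f a)).ncard = (G.neighborSet a).ncard := by
  rw [← Set.ncard_image_of_injective (G.neighborSet a) f.injective]
  congr 1
  ext w
  simp

variable [Finite V] [DecidableEq V]

theorem ncard_neighborSet_sup_edge (G : SimpleGraph V) {a b : V} (hab : a ≠ b)
    (h : ¬ G.Adj a b) (u : V) :
    ((G ⊔ edge a b).neighborSet u).ncard =
      (G.neighborSet u).ncard + if u = a ∨ u = b then 1 else 0 := by
  have h' : ¬ G.Adj b a := fun hh => h hh.symm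
  by_cases hua : u = a
  · subst hua
    have : (G ⊔ edge u b).neighborSet u = insert b (G.neighborSet u) := by
      ext w
      simp only [mem_neighborSet, sup_adj, edge_adj, Set.mem_insert_iff]
      grind
    rw [this, Set.ncard_insert_of_notMem (by simpa using h)]
    simp
  · by_cases hub : u = b
    · subst hub
      have : (G ⊔ edge a u).neighborSet u = insert a (G.neighborSet u) := by
        ext w
        simp only [mem_neighborSet, sup_adj, edge_adj, Set.mem_insert_iff]
        grind
      rw [this, Set.ncard_insert_of_notMem (by simpa using h')]
      simp
    · have : (G ⊔ edge a b).neighborSet u = G.neighborSet u := by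
        ext w
        simp only [mem_neighborSet, sup_adj, edge_adj]
        grind
      rw [this]
      simp [hua, hub]

theorem ncard_neighborSet_sdiff_edge_add (G : SimpleGraph V) {a b : V} (h : G.Adj a b) (u : V) :
    ((G \ edge a b).neighborSet u).ncard + (if u = a ∨ u = b then 1 else 0) =
      (G.neighborSet u).ncard := by
  have hle : edge a b ≤ G := by
    intro x y hxy
    rw [edge_adj] at hxy
    rcases hxy with ⟨⟨rfl, rfl⟩ | ⟨rfl, rfl⟩, -⟩
    · exact h
    · exact h.symm
  rw [← ncard_neighborSet_sup_edge (G \ edge a b) h.ne (by simp [edge_adj, h.ne]),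
    sdiff_sup_cancel hle]

/-- Every isolated vertex of `Q` can be turned into a vertex of degree one, at the cost of
increasing the degree of `v` by one each time and leaving all the other degrees unchanged. -/
theorem exists_ncard_neighborSet_add_card (v : V) (R : Finset V) (hvR : v ∉ R) (Q : Finset V) :
    ∀ G : SimpleGraph V, v ∉ Q → Disjoint R Q → (∀ q ∈ Q, (G.neighborSet q).ncard = 0) →
    (∀ r ∈ R, 0 < (G.neighborSet r).ncard) → G.neighborSet v ⊆ R →
    (G.neighborSet v).ncard + Q.card ≤ R.card →
    ∃ G' : SimpleGraph V, (G'.neighborSet v).ncard = (G.neighborSet v).ncard + Q.card ∧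
      G'.neighborSet v ⊆ R ∧ (∀ q ∈ Q, (G'.neighborSet q).ncard = 1) ∧
      ∀ u, u ≠ v → u ∉ Q → (G'.neighborSet u).ncard = (G.neighborSet u).ncard := by
  induction Q using Finset.induction_on with
  | empty =>
    intro G _ _ _ _ hN _
    exact ⟨G, by simp, hN, by simp, fun _ _ _ => rfl⟩
  | insert p Q hp ih =>
    intro G hvQ hRQ hQ hR hN hcard
    rw [Finset.card_insert_of_notMem hp] at hcard
    have hpv : p ≠ v := by grind
    have hpR : p ∉ R := by
      intro h
      exact Finset.disjoint_left.1 hRQ h (Finset.mem_insert_self _ _)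
    obtain ⟨w, hwR, hw⟩ : ∃ w ∈ (R : Set V), w ∉ G.neighborSet v := by
      refine Set.exists_mem_notMem_of_ncard_lt_ncard ?_ (Set.toFinite _)
      rw [Set.ncard_coe_finset]
      omega
    have hwR' : w ∈ R := hwR
    obtain ⟨x, hx⟩ := (Set.ncard_pos (Set.toFinite _)).1 (hR w hwR)
    have hwx : G.Adj w x := hx
    have hvw : ¬ G.Adj v w := hw
    have hp0 : ∀ y, ¬ G.Adj p y := by
      intro y hy
      have := hQ p (Finset.mem_insert_self _ _)
      rw [Set.ncard_eq_zero] at this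
      have : y ∈ (∅ : Set V) := this ▸ hy
      simp at this
    have hxp : x ≠ p := by rintro rfl; exact hp0 _ hwx.symm
    have hxv : x ≠ v := by rintro rfl; exact hvw hwx.symm
    have hwv : w ≠ v := by rintro rfl; exact hvR hwR
    have hwp : w ≠ p := by rintro rfl; exact hpR hwR
    have hwx' := hwx.ne
    have hvp : ¬ G.Adj x p := fun h => hp0 _ h.symm
    set G₁ : SimpleGraph V := G \ edge w x ⊔ edge x p ⊔ edge v w with hG₁
    have hdeg : ∀ u, (G₁.neighborSet u).ncard =
        (G.neighborSet u).ncard + if u = v ∨ u = p then 1 else 0 := by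
      intro u
      have h1 := ncard_neighborSet_sdiff_edge_add G hwx u
      have h2 := ncard_neighborSet_sup_edge (G \ edge w x) hxp (by simp [hvp]) u
      have h3 := ncard_neighborSet_sup_edge (G \ edge w x ⊔ edge x p) hwv.symm
        (by simp only [sup_adj, sdiff_adj, edge_adj]; grind) u
      rw [hG₁]
      grind
    have hN₁ : G₁.neighborSet v ⊆ R := by
      intro y hy
      have : y = w ∨ G.Adj v y := by
        simp only [hG₁, mem_neighborSet, sup_adj, sdiff_adj, edge_adj] at hy
        grind
      rcases this with rfl | h
      · exact hwR
      · exact hN h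
    obtain ⟨G', h1, h2, h3, h4⟩ := ih G₁ (by grind)
      (hRQ.mono_right (Finset.subset_insert _ _)) (by
        intro q hq
        rw [hdeg, hQ q (Finset.mem_insert_of_mem hq)]
        grind)
      (by intro r hr; rw [hdeg]; have := hR r hr; omega) hN₁ (by
        rw [hdeg]; simp; omega)
    refine ⟨G', ?_, h2, ?_, ?_⟩
    · rw [h1, hdeg, Finset.card_insert_of_notMem hp]; simp; omega
    · intro q hq
      rcases Finset.mem_insert.1 hq with rfl | hq
      · rw [h4 q hpv hp, hdeg, hQ q hq]; simp
      · exact h3 q hq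
    · intro u huv huQ
      rw [h4 u huv (by grind), hdeg]
      grind

/-- Every vertex of degree one in `Q` can be isolated, at the cost of decreasing the degree of `v`
by one each time and leaving all the other degrees unchanged, provided that the degree of `v`
is large enough. -/
theorem exists_ncard_neighborSet_add_card_eq (v : V) (D : ℕ) (Q : Finset V) :
    ∀ G : SimpleGraph V, v ∉ Q → (∀ q ∈ Q, (G.neighborSet q).ncard = 1) →
    (∀ q ∈ Q, ¬ G.Adj v q) → (G.neighborSet v).ncard = D + Q.card →
    (∀ u, u ≠ v → (G.neighborSet u).ncard ≤ D) →
    ∃ G' : SimpleGraph V, (G'.neighborSet v).ncard = D ∧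
      (∀ q ∈ Q, (G'.neighborSet q).ncard = 0) ∧
      ∀ u, u ≠ v → u ∉ Q → (G'.neighborSet u).ncard = (G.neighborSet u).ncard := by
  induction Q using Finset.induction_on with
  | empty =>
    intro G _ _ _ hv _
    exact ⟨G, by simpa using hv, by simp, fun _ _ _ => rfl⟩
  | insert p Q hp ih =>
    intro G hvQ hQ hN hv hD
    rw [Finset.card_insert_of_notMem hp] at hv
    have hpv : p ≠ v := by grind
    have hvp : ¬ G.Adj v p := hN p (Finset.mem_insert_self _ _)
    have hp1 := hQ p (Finset.mem_insert_self _ _)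
    obtain ⟨x, hx⟩ := (Set.ncard_pos (Set.toFinite _)).1 (hp1 ▸ Nat.one_pos)
    have hpx : G.Adj p x := hx
    have hxv : x ≠ v := by rintro rfl; exact hvp hpx.symm
    obtain ⟨w, hwv', hw⟩ : ∃ w ∈ G.neighborSet v, w ∉ insert x (G.neighborSet x \ {p}) := by
      refine Set.exists_mem_notMem_of_ncard_lt_ncard ?_ (Set.toFinite _)
      have h1 := Set.ncard_insert_le x (G.neighborSet x \ {p})
      have h2 := Set.ncard_sdiff_singleton_add_one (s := G.neighborSet x) (a := p) hpx.symm
      have h3 := hD x hxv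
      omega
    have hvw : G.Adj v w := hwv'
    have hwp : w ≠ p := by rintro rfl; exact hvp hvw
    have hwx : w ≠ x := by rintro rfl; simp at hw
    have hxw : ¬ G.Adj x w := by
      intro h
      exact hw (Set.mem_insert_of_mem _ ⟨h, hwp⟩)
    have hwv := hvw.ne
    have hpx' := hpx.ne
    set G₁ : SimpleGraph V := (G \ edge v w) \ edge p x ⊔ edge x w with hG₁
    have hdeg : ∀ u, (G₁.neighborSet u).ncard + (if u = v ∨ u = p then 1 else 0) =
        (G.neighborSet u).ncard := by
      intro u
      have h1 := ncard_neighborSet_sdiff_edge_add G hvw u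
      have h2 := ncard_neighborSet_sdiff_edge_add (G \ edge v w) (a := p) (b := x)
        (by simp only [sdiff_adj, edge_adj]; grind) u
      have h3 := ncard_neighborSet_sup_edge ((G \ edge v w) \ edge p x) hwx.symm
        (by simp [hxw]) u
      rw [hG₁]
      grind
    obtain ⟨G', h1, h2, h3⟩ := ih G₁ (by grind)
      (by
        intro q hq
        have := hdeg q
        have := hQ q (Finset.mem_insert_of_mem hq)
        grind)
      (by
        intro q hq
        have := hN q (Finset.mem_insert_of_mem hq)
        simp only [hG₁, sup_adj, sdiff_adj, edge_adj]
        grind)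
      (by have := hdeg v; simp at this; omega)
      (by intro u hu; have := hdeg u; have := hD u hu; omega)
    refine ⟨G', h1, ?_, ?_⟩
    · intro q hq
      rcases Finset.mem_insert.1 hq with rfl | hq
      · have := hdeg q
        rw [h3 q hpv hp]
        simp at this
        omega
      · exact h2 q hq
    · intro u huv huQ
      rw [h3 u huv (by grind), ← hdeg]
      grind

end SimpleGraph

theorem exists_equiv_of_map_univ_val_eq {V W γ : Type*} [Fintype V] [Fintype W] {f : V → γ}
    {g : W → γ} (h : Finset.univ.val.map f = Finset.univ.val.map g) :
    ∃ e : V ≃ W, ∀ a, g (e a) = f a := by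
  classical
  have key : ∀ c, Nonempty ({a // f a = c} ≃ {b // g b = c}) := by
    intro c
    rw [← Fintype.card_eq, Fintype.card_subtype, Fintype.card_subtype]
    have hc := congrArg (Multiset.count c) h
    rw [Multiset.count_map, Multiset.count_map] at hc
    simpa only [eq_comm, Finset.card_def, Finset.filter_val] using hc
  exact ⟨Equiv.ofFiberEquiv fun c => (key c).some, Equiv.ofFiberEquiv_map _⟩

theorem isGraphic_map_univ_iff {ι : Type} [Fintype ι] (f : ι → ℕ) :
    IsGraphic (Finset.univ.val.map f) ↔
      ∃ G : SimpleGraph ι, ∀ i, (G.neighborSet i).ncard = f i := by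
  constructor
  · rintro ⟨V, _, G, hG⟩
    obtain ⟨e, he⟩ := exists_equiv_of_map_univ_val_eq hG.symm
    refine ⟨G.comap e, fun i => ?_⟩
    rw [G.ncard_neighborSet_comap e.injective i (by simp), he]
  · rintro ⟨G, hG⟩
    exact ⟨ι, inferInstance, G, by simp [degreeMultiset, hG]⟩

/-- A degree assignment on `Option α` whose largest value `D` is at `none` is realizable if and only
if the assignment obtained by deleting `none`, decreasing all the other values by one and adding
`card α - D` values equal to one is realizable. -/
theorem exists_simpleGraph_option_iff {α : Type*} [Fintype α] (e : α → ℕ) (D k : ℕ)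
    (hD : 0 < D) (he : ∀ a, 0 < e a) (heD : ∀ a, e a ≤ D)
    (hk : D + k = Fintype.card α) :
    (∃ G : SimpleGraph (Option α), ∀ i, (G.neighborSet i).ncard = i.elim D e) ↔
      ∃ H : SimpleGraph (α ⊕ Fin k), ∀ i,
        (H.neighborSet i).ncard = Sum.elim (fun a => e a - 1) (fun _ => 1) i := by
  classical
  let R : Finset (Option (α ⊕ Fin k)) :=
    Finset.univ.map (Function.Embedding.inl.trans Function.Embedding.some)
  let Q : Finset (Option (α ⊕ Fin k)) :=
    Finset.univ.map (Function.Embedding.inr.trans Function.Embedding.some)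
  let f : Option α ↪ Option (α ⊕ Fin k) := Function.Embedding.inl.optionMap
  have hR : R.card = D + k := by simp [R, hk]
  have hQ : Q.card = k := by simp [Q]
  have hsome : Function.Injective (some : α ⊕ Fin k → _) := Option.some_injective _
  have hrange : (Set.range (some : α ⊕ Fin k → _))ᶜ = {none} := by
    ext x; cases x <;> simp
  constructor
  · rintro ⟨G, hG⟩
    have hK : ∀ i, ((G.map f).neighborSet (f i)).ncard = i.elim D e := fun i => by
      rw [G.ncard_neighborSet_map, hG]
    have hKv : ((G.map f).neighborSet none).ncard = D := hK none
    have hKR : ∀ a, ((G.map f).neighborSet (some (Sum.inl a))).ncard = e a := fun a => hK (some a)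
    obtain ⟨G', h1, h2, h3, h4⟩ := SimpleGraph.exists_ncard_neighborSet_add_card none R
      (by simp [R]) Q (G.map f) (by simp [Q])
      (by simp [R, Q, Finset.disjoint_left])
      (by
        simp only [Q, Finset.mem_map, Finset.mem_univ, true_and, forall_exists_index,
          forall_apply_eq_imp_iff]
        intro j
        rw [Set.ncard_eq_zero, Set.eq_empty_iff_forall_notMem]
        rintro x ⟨-, u, w, -, hu, -⟩
        cases u <;> simp [f] at hu)
      (by
        simp only [R, Finset.mem_map, Finset.mem_univ, true_and, forall_exists_index,
          forall_apply_eq_imp_iff]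
        intro a
        exact (he a).trans_eq (hKR a).symm)
      (by
        rintro x ⟨-, u, w, huw, hu, rfl⟩
        cases u with
        | some u => simp [f] at hu
        | none =>
          cases w with
          | none => exact absurd huw G.irrefl
          | some w => simp [R, f])
      (by rw [hKv, hQ, hR])
    have hN : G'.neighborSet none = R :=
      Set.eq_of_subset_of_ncard_le h2
        (by rw [h1, hKv, hQ, Set.ncard_coe_finset, hR]) (Set.toFinite _)
    refine ⟨G'.comap some, fun i => ?_⟩
    have hi := G'.ncard_neighborSet_comap_add hsome i
    rw [Set.sdiff_eq, hrange] at hi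
    cases i with
    | inl a =>
      have : G'.Adj (some (Sum.inl a)) none := by
        rw [SimpleGraph.adj_comm, ← SimpleGraph.mem_neighborSet, hN]
        simp [R]
      rw [Set.inter_eq_self_of_subset_right (by simpa using this), Set.ncard_singleton,
        h4 _ (by simp) (by simp [Q]), hKR] at hi
      simp only [Sum.elim_inl]
      omega
    | inr j =>
      have : ¬ G'.Adj (some (Sum.inr j)) none := by
        rw [SimpleGraph.adj_comm, ← SimpleGraph.mem_neighborSet, hN]
        simp [R]
      rw [Set.inter_singleton_eq_empty.2 (by simpa using this), Set.ncard_empty, h3 _ (by simp [Q])] at hi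
      simp only [Sum.elim_inr]
      omega
  · rintro ⟨H, hH⟩
    let K : SimpleGraph (Option (α ⊕ Fin k)) :=
      H.map Function.Embedding.some ⊔ SimpleGraph.fromRel fun x y => x = none ∧ y ∈ R
    have hKcomap : K.comap some = H := by
      ext x y
      simp only [K, SimpleGraph.comap_adj, SimpleGraph.sup_adj, SimpleGraph.fromRel_adj,
        SimpleGraph.map_adj]
      simp
    have hKv : K.neighborSet none = R := by
      ext x
      cases x <;> simp [K, R, SimpleGraph.map_adj']
    have hKR : ∀ a, (K.neighborSet (some (Sum.inl a))).ncard = e a := by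
      intro a
      have hi := K.ncard_neighborSet_comap_add hsome (Sum.inl a)
      have : K.Adj (some (Sum.inl a)) none := by
        rw [SimpleGraph.adj_comm, ← SimpleGraph.mem_neighborSet, hKv]
        simp [R]
      rw [Set.sdiff_eq, hrange, Set.inter_eq_self_of_subset_right (by simpa using this),
        Set.ncard_singleton, hKcomap, hH, Sum.elim_inl] at hi
      have := he a
      omega
    have hKQ : ∀ j, (K.neighborSet (some (Sum.inr j))).ncard = 1 := by
      intro j
      have hi := K.ncard_neighborSet_comap_add hsome (Sum.inr j)
      have : ¬ K.Adj (some (Sum.inr j)) none := by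
        rw [SimpleGraph.adj_comm, ← SimpleGraph.mem_neighborSet, hKv]
        simp [R]
      rw [Set.sdiff_eq, hrange, Set.inter_singleton_eq_empty.2 (by simpa using this), Set.ncard_empty,
        hKcomap, hH, Sum.elim_inr] at hi
      omega
    obtain ⟨G', h1, h2, h3⟩ := SimpleGraph.exists_ncard_neighborSet_add_card_eq none D Q K
      (by simp [Q]) (by simpa [Q] using hKQ)
      (by
        intro q hq
        rw [← SimpleGraph.mem_neighborSet, hKv]
        simp only [Q, Finset.mem_map, Finset.mem_univ, true_and] at hq
        obtain ⟨j, rfl⟩ := hq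
        simp [R])
      (by rw [hKv, Set.ncard_coe_finset, hR, hQ])
      (by
        intro u hu
        rcases u with _ | a | j
        · exact absurd rfl hu
        · rw [hKR]
          exact heD a
        · rw [hKQ]
          exact hD)
    refine ⟨G'.comap f, fun i => ?_⟩
    rw [G'.ncard_neighborSet_comap f.injective]
    · cases i with
      | none => exact h1
      | some a =>
        exact (h3 (some (Sum.inl a)) (by simp) (by simp [Q])).trans (hKR a)
    · intro x hx
      rcases x with _ | a | j
      · exact ⟨none, rfl⟩
      · exact ⟨some a, rfl⟩
      · have h0 := h2 (some (Sum.inr j)) (by simp [Q])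
        rw [Set.ncard_eq_zero] at h0
        have : f i ∈ G'.neighborSet (some (Sum.inr j)) := SimpleGraph.Adj.symm hx
        simp [h0] at this

/-- A non-increasing sequence `(d 1, …, d n)` of positive integers with
`n ≥ 2` and `d 1 ≤ n - 1` is graphic if and only if the sequence consisting of
`d 2 - 1, …, d n - 1` together with `n - 1 - d 1` additional entries equal to `1`
is graphic. -/
theorem stmt5 (n : ℕ) (d : ℕ → ℕ) (hn : 2 ≤ n)
    (hpos : ∀ i ∈ Finset.Icc 1 n, 0 < d i)
    (hmono : ∀ i j, 1 ≤ i → i ≤ j → j ≤ n → d j ≤ d i)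
    (hd1 : d 1 ≤ n - 1) :
    IsGraphic ((Finset.Icc 1 n).val.map d) ↔
    IsGraphic ((Finset.Icc 2 n).val.map (fun i => d i - 1) +
      Multiset.replicate (n - 1 - d 1) 1) := by
  have hLHS : (Finset.Icc 1 n).val.map d =
      Finset.univ.val.map fun i : Option (Finset.Icc 2 n) => i.elim (d 1) fun a => d a := by
    rw [← Finset.insert_Icc_add_one_left_eq_Icc (by omega : 1 ≤ n),
      Finset.insert_val_of_notMem (by simp), Multiset.map_cons, univ_option]
    simp only [Finset.insertNone, OrderEmbedding.coe_ofMapLEIff, Finset.cons_val,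
      Multiset.map_cons, Finset.map_val, Multiset.map_map]
    congr 1
    exact (Multiset.attach_map_val' _ d).symm
  have hRHS : (Finset.Icc 2 n).val.map (fun i => d i - 1) + Multiset.replicate (n - 1 - d 1) 1 =
      Finset.univ.val.map (Sum.elim (fun a : Finset.Icc 2 n => d a - 1)
        fun _ : Fin (n - 1 - d 1) => 1) := by
    rw [← Finset.univ_disjSum_univ, Finset.val_disjSum, Multiset.disjSum, Multiset.map_add,
      Multiset.map_map, Multiset.map_map]
    congr 1
    · exact (Multiset.attach_map_val' _ fun i => d i - 1).symm
    · simp [Function.comp_def]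
  rw [hLHS, hRHS, isGraphic_map_univ_iff, isGraphic_map_univ_iff]
  refine exists_simpleGraph_option_iff _ _ _ (hpos 1 (by simp; omega)) ?_ ?_ ?_
  · rintro ⟨a, ha⟩
    exact hpos a (by simp at ha ⊢; omega)
  · rintro ⟨a, ha⟩
    rw [Finset.mem_Icc] at ha
    exact hmono 1 a le_rfl (by omega) ha.2
  · simp
    omega
end

section
/- Let (d_1, …, d_n) be a non-increasing sequence of positive integers with n ≥ 2, and let x be a natural number. Let G be a finite simple graph whose degree multiset is {d_1, …, d_n}, and let G' be a finite simple graph whose degree multiset is {d_2 − 1, …, d_n − 1} together with x copies of 1. Then: (i) |V(G)| + x = 1 + |V(G')|; (ii) 2·|E(G)| + 2x = d_1 + 2·|E(G')| + |V(G')|; (iii) sub(S_2, G) + x = C(d_1, 2) + sub(S_2, G') + 2·|E(G')|; and (iv) for every j ≥ 3, sub(S_j, G) = C(d_1, j) + sub(S_j, G') + sub(S_{j−1}, G'). -/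
/-- The star `S_j` with `j` leaves: vertex `0` is the centre, adjacent to the `j` leaves. -/
def starGraph (j : ℕ) : SimpleGraph (Fin (j + 1)) :=
  SimpleGraph.fromRel (fun a _ => a = 0)

/-- The number of subgraphs of `G` isomorphic to `F`. -/
noncomputable def subCount {α β : Type*} (F : SimpleGraph α) (G : SimpleGraph β) : ℕ :=
  Nat.card {H : G.Subgraph // Nonempty (F ≃g H.coe)}

/-- The star subgraph of `G` with centre `v` and leaf set `s`. -/
def starSubgraph {V : Type*} (G : SimpleGraph V) (v : V) (s : Finset V)
    (hs : ∀ w ∈ s, G.Adj v w) : G.Subgraph where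
  verts := {a | a = v ∨ a ∈ s}
  Adj a b := (a = v ∧ b ∈ s) ∨ (b = v ∧ a ∈ s)
  adj_sub := by
    rintro a b (⟨rfl, h⟩ | ⟨rfl, h⟩)
    · exact hs _ h
    · exact (hs _ h).symm
  edge_vert := by
    rintro a b (⟨rfl, h⟩ | ⟨rfl, h⟩)
    · exact Or.inl rfl
    · exact Or.inr h
  symm := ⟨fun _ _ h => h.symm⟩

theorem starGraph_adj {j : ℕ} (a b : Fin (j + 1)) :
    (starGraph j).Adj a b ↔ a ≠ b ∧ (a = 0 ∨ b = 0) :=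
  SimpleGraph.fromRel_adj _ _ _

theorem nonempty_iso_starSubgraph {V : Type*} (G : SimpleGraph V) (v : V) (s : Finset V)
    (hs : ∀ w ∈ s, G.Adj v w) {j : ℕ} (hj : s.card = j) :
    Nonempty (starGraph j ≃g (starSubgraph G v s hs).coe) := by
  subst hj
  have hv : v ∉ s := fun h => G.loopless.irrefl v (hs v h)
  let e : Fin s.card ≃ s := s.equivFin.symm
  let f : Fin (s.card + 1) → (starSubgraph G v s hs).verts :=
    Fin.cases ⟨v, Or.inl rfl⟩ fun i => ⟨e i, Or.inr (e i).2⟩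
  have hf0 : (f 0 : V) = v := rfl
  have hfs (i : Fin s.card) : (f i.succ : V) = e i := rfl
  have hne (i : Fin s.card) : (e i : V) ≠ v := fun h => hv (h ▸ (e i).2)
  have hbij : Function.Bijective f := by
    constructor
    · intro a b hab
      replace hab := congrArg Subtype.val hab
      induction a using Fin.cases with
      | zero =>
        induction b using Fin.cases with
        | zero => rfl
        | succ b => exact absurd hab.symm (hne b)
      | succ a =>
        induction b using Fin.cases with
        | zero => exact absurd hab (hne a)
        | succ b => exact congrArg Fin.succ (e.injective (Subtype.ext hab))
    · rintro ⟨a, rfl | ha⟩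
      · exact ⟨0, rfl⟩
      · exact ⟨(e.symm ⟨a, ha⟩).succ, Subtype.ext (by rw [hfs]; simp)⟩
  refine ⟨⟨Equiv.ofBijective f hbij, ?_⟩⟩
  intro a b
  rw [starGraph_adj]
  change ((f a : V) = v ∧ (f b : V) ∈ s) ∨ ((f b : V) = v ∧ (f a : V) ∈ s) ↔ _
  induction a using Fin.cases with
  | zero =>
    induction b using Fin.cases with
    | zero => simp [hf0, hv]
    | succ b => simp [hf0, hfs, (Fin.succ_ne_zero b).symm]
  | succ a =>
    induction b using Fin.cases with
    | zero => simp [hf0, hfs]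
    | succ b => simp [hfs, hne]

theorem exists_eq_starSubgraph {V : Type*} {G : SimpleGraph V} {j : ℕ} (H : G.Subgraph)
    (φ : starGraph j ≃g H.coe) :
    ∃ (v : V) (s : Finset V) (hs : ∀ w ∈ s, G.Adj v w),
      s.card = j ∧ starSubgraph G v s hs = H := by
  classical
  have hadj (a b : Fin (j + 1)) : H.Adj (φ a) (φ b) ↔ a ≠ b ∧ (a = 0 ∨ b = 0) := by
    rw [← starGraph_adj]
    exact φ.map_rel_iff
  have hinj : Function.Injective fun a => (φ a : V) :=
    Subtype.val_injective.comp φ.injective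
  have hmem (a : Fin (j + 1)) :
      (φ a : V) ∈ Finset.univ.image (fun i : Fin j => (φ i.succ : V)) ↔ a ≠ 0 := by
    rw [Finset.mem_image]
    constructor
    · rintro ⟨i, -, hi⟩
      rw [← hinj hi]
      exact Fin.succ_ne_zero i
    · intro ha
      obtain ⟨i, rfl⟩ := Fin.exists_succ_eq.2 ha
      exact ⟨i, Finset.mem_univ _, rfl⟩
  refine ⟨φ 0, Finset.univ.image fun i : Fin j => (φ i.succ : V), ?_, ?_, ?_⟩
  · intro w hw
    obtain ⟨i, -, rfl⟩ := Finset.mem_image.1 hw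
    exact H.adj_sub ((hadj _ _).2 ⟨(Fin.succ_ne_zero i).symm, Or.inl rfl⟩)
  · exact (Finset.card_image_of_injective _ (hinj.comp (Fin.succ_injective j))).trans
      (Finset.card_fin j)
  · have hverts (a : V) : a = φ 0 ∨ a ∈ Finset.univ.image (fun i : Fin j => (φ i.succ : V)) ↔
        a ∈ H.verts := by
      constructor
      · rintro (rfl | h)
        · exact (φ 0).2
        · obtain ⟨i, -, rfl⟩ := Finset.mem_image.1 h
          exact (φ i.succ).2
      · intro h
        obtain ⟨i, hi⟩ := φ.surjective ⟨a, h⟩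
        obtain rfl : (φ i : V) = a := congrArg Subtype.val hi
        rw [hmem, hinj.eq_iff]
        exact em _
    refine SimpleGraph.Subgraph.ext (Set.ext hverts) ?_
    ext a b
    by_cases hab : a ∈ H.verts ∧ b ∈ H.verts
    · obtain ⟨ha, hb⟩ := hab
      obtain ⟨i, hi⟩ := φ.surjective ⟨a, ha⟩
      obtain ⟨k, hk⟩ := φ.surjective ⟨b, hb⟩
      obtain rfl : (φ i : V) = a := congrArg Subtype.val hi
      obtain rfl : (φ k : V) = b := congrArg Subtype.val hk
      rw [hadj]
      change ((φ i : V) = φ 0 ∧ _) ∨ ((φ k : V) = φ 0 ∧ _) ↔ _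
      rw [hmem, hmem, hinj.eq_iff, hinj.eq_iff]
      grind
    · refine iff_of_false (fun h => hab ?_) fun h => hab ⟨H.edge_vert h, H.edge_vert h.symm⟩
      rw [← hverts, ← hverts]
      exact ⟨(starSubgraph G _ _ _).edge_vert h, (starSubgraph G _ _ _).edge_vert h.symm⟩

theorem starSubgraph_injective {V : Type*} {G : SimpleGraph V} {v w : V} {s t : Finset V}
    {hs : ∀ a ∈ s, G.Adj v a} {ht : ∀ a ∈ t, G.Adj w a} (hcard : 2 ≤ t.card)
    (h : starSubgraph G v s hs = starSubgraph G w t ht) : v = w ∧ s = t := by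
  have hadj (a b : V) : (a = v ∧ b ∈ s) ∨ (b = v ∧ a ∈ s) ↔ (a = w ∧ b ∈ t) ∨ (b = w ∧ a ∈ t) :=
    iff_of_eq (congrFun (congrFun (congrArg SimpleGraph.Subgraph.Adj h) a) b)
  have hvs : v ∉ s := fun h => G.loopless.irrefl v (hs v h)
  have hwt : w ∉ t := fun h => G.loopless.irrefl w (ht w h)
  have hvw : v = w := by
    obtain ⟨a, ha, b, hb, hne⟩ := Finset.one_lt_card.1 hcard
    have h1 := hadj w a
    have h2 := hadj w b
    grind
  subst hvw
  refine ⟨rfl, Finset.ext fun a => ?_⟩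
  have h1 := hadj v a
  grind

theorem ncard_neighborSet_eq_degree {V : Type*} (G : SimpleGraph V) (v : V)
    [Fintype (G.neighborSet v)] : (G.neighborSet v).ncard = G.degree v := by
  rw [Set.ncard_eq_toFinset_card']
  rfl

/-- For `j ≥ 2` the number of `j`-stars is a sum of binomial coefficients of the degrees. -/
theorem subCount_starGraph {V : Type*} [Fintype V] (G : SimpleGraph V) {j : ℕ} (hj : 2 ≤ j) :
    subCount (starGraph j) G = ((degreeMultiset G).map fun k => k.choose j).sum := by
  classical
  have hadj {v : V} {s : Finset V} (hs : s ∈ (G.neighborFinset v).powersetCard j) :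
      ∀ w ∈ s, G.Adj v w := fun w hw =>
    (G.mem_neighborFinset v w).1 ((Finset.mem_powersetCard.1 hs).1 hw)
  let f : (Σ v : V, {s : Finset V // s ∈ (G.neighborFinset v).powersetCard j}) →
      {H : G.Subgraph // Nonempty (starGraph j ≃g H.coe)} := fun p =>
    ⟨starSubgraph G p.1 p.2.1 (hadj p.2.2),
      nonempty_iso_starSubgraph G _ _ _ (Finset.mem_powersetCard.1 p.2.2).2⟩
  have hf : Function.Bijective f := by
    constructor
    · rintro ⟨v, s, hs⟩ ⟨w, t, ht⟩ h
      obtain ⟨rfl, rfl⟩ := starSubgraph_injective (hs := hadj hs) (ht := hadj ht)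
        (by rwa [(Finset.mem_powersetCard.1 ht).2]) (congrArg Subtype.val h)
      rfl
    · rintro ⟨H, ⟨φ⟩⟩
      obtain ⟨v, s, hs, hc, rfl⟩ := exists_eq_starSubgraph H φ
      exact ⟨⟨v, s, Finset.mem_powersetCard.2
        ⟨fun w hw => (G.mem_neighborFinset _ _).2 (hs w hw), hc⟩⟩, rfl⟩
  rw [subCount, ← Nat.card_eq_of_bijective f hf, Nat.card_eq_fintype_card, Fintype.card_sigma,
    degreeMultiset, Multiset.map_map]
  refine Finset.sum_congr rfl fun v _ => ?_
  rw [Fintype.card_coe, Finset.card_powersetCard, G.card_neighborFinset_eq_degree,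
    ← ncard_neighborSet_eq_degree]
  rfl

theorem two_mul_ncard_edgeSet {V : Type*} [Fintype V] (G : SimpleGraph V) :
    2 * G.edgeSet.ncard = (degreeMultiset G).sum := by
  classical
  rw [← G.coe_edgeFinset, Set.ncard_coe_finset, ← G.sum_degrees_eq_twice_card_edges,
    degreeMultiset]
  exact Finset.sum_congr rfl fun v _ => (ncard_neighborSet_eq_degree G v).symm

theorem card_degreeMultiset {V : Type*} [Fintype V] (G : SimpleGraph V) :
    (degreeMultiset G).card = Fintype.card V := by
  simp [degreeMultiset]

/-- relating the star subgraph counts of a graph `G` with degree multiset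
`{d 1, …, d n}` and a graph `G'` with degree multiset `{d 2 - 1, …, d n - 1}` together
with `x` copies of `1`. -/
theorem stmt6 {V V' : Type*} [Fintype V] [Fintype V'] (n : ℕ) (d : ℕ → ℕ) (x : ℕ)
    (hn : 2 ≤ n)
    (hpos : ∀ i ∈ Finset.Icc 1 n, 0 < d i)
    (hmono : ∀ i j, 1 ≤ i → i ≤ j → j ≤ n → d j ≤ d i)
    (G : SimpleGraph V) (G' : SimpleGraph V')
    (hG : degreeMultiset G = (Finset.Icc 1 n).val.map d)
    (hG' : degreeMultiset G' = (Finset.Icc 2 n).val.map (fun i => d i - 1) +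
      Multiset.replicate x 1) :
    Fintype.card V + x = 1 + Fintype.card V' ∧
    2 * G.edgeSet.ncard + 2 * x = d 1 + 2 * G'.edgeSet.ncard + Fintype.card V' ∧
    subCount (starGraph 2) G + x
      = (d 1).choose 2 + subCount (starGraph 2) G' + 2 * G'.edgeSet.ncard ∧
    ∀ j : ℕ, 3 ≤ j → subCount (starGraph j) G
      = (d 1).choose j + subCount (starGraph j) G' + subCount (starGraph (j - 1)) G' := by
  have hIcc : Finset.Icc 1 n = insert 1 (Finset.Icc 2 n) := by
    ext i
    simp only [Finset.mem_insert, Finset.mem_Icc]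
    omega
  have hnot : 1 ∉ Finset.Icc 2 n := by simp
  have hsum (g : ℕ → ℕ) : ((degreeMultiset G).map g).sum
      = g (d 1) + ∑ i ∈ Finset.Icc 2 n, g (d i) := by
    rw [hG, Multiset.map_map]
    change ∑ i ∈ Finset.Icc 1 n, g (d i) = _
    rw [hIcc, Finset.sum_insert hnot]
  have hsum' (g : ℕ → ℕ) : ((degreeMultiset G').map g).sum
      = ∑ i ∈ Finset.Icc 2 n, g (d i - 1) + x * g 1 := by
    rw [hG', Multiset.map_add, Multiset.sum_add, Multiset.map_map, Multiset.map_replicate,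
      Multiset.sum_replicate, smul_eq_mul]
    rfl
  have hpos' : ∀ i ∈ Finset.Icc 2 n, d i = d i - 1 + 1 := by
    intro i hi
    have := hpos i (hIcc ▸ Finset.mem_insert_of_mem hi)
    omega
  have hchoose (k : ℕ) : ∑ i ∈ Finset.Icc 2 n, (d i).choose (k + 1)
      = ∑ i ∈ Finset.Icc 2 n, (d i - 1).choose k
        + ∑ i ∈ Finset.Icc 2 n, (d i - 1).choose (k + 1) := by
    rw [← Finset.sum_add_distrib]
    refine Finset.sum_congr rfl fun i hi => ?_
    conv_lhs => rw [hpos' i hi, Nat.choose_succ_succ]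
  have hV : Fintype.card V = n := by
    rw [← card_degreeMultiset G, hG]
    simp
  have hV' : Fintype.card V' = n - 1 + x := by
    rw [← card_degreeMultiset G', hG']
    simp
  have hE := two_mul_ncard_edgeSet G
  have hE' := two_mul_ncard_edgeSet G'
  rw [← Multiset.map_id' (degreeMultiset G), hsum] at hE
  rw [← Multiset.map_id' (degreeMultiset G'), hsum'] at hE'
  refine ⟨by omega, ?_, ?_, ?_⟩
  · have h := hchoose 0
    simp only [Nat.choose_zero_right, zero_add, Nat.choose_one_right, Finset.sum_const,
      Nat.card_Icc, smul_eq_mul, mul_one] at h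
    omega
  · have h := hchoose 1
    simp only [Nat.choose_one_right, Nat.reduceAdd] at h
    rw [subCount_starGraph G le_rfl, subCount_starGraph G' le_rfl, hsum, hsum', h,
      Nat.choose_eq_zero_of_lt one_lt_two]
    omega
  · intro j hj
    have h := hchoose (j - 1)
    rw [Nat.sub_add_cancel (by omega)] at h
    rw [subCount_starGraph G (by omega), subCount_starGraph G' (by omega),
      subCount_starGraph G' (by omega), hsum, hsum', hsum', h,
      Nat.choose_eq_zero_of_lt (show 1 < j by omega),
      Nat.choose_eq_zero_of_lt (show 1 < j - 1 by omega)]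
    omega
end

section
/- Let F_1, …, F_k be finite simple graphs and m_1, …, m_k natural numbers. If there exists a finite simple graph G with hom(F_i, G) = m_i for every i ∈ [k], then there exists a finite simple graph G' with at most ∑_{i=1}^k m_i·|V(F_i)| vertices such that hom(F_i, G') = m_i for every i ∈ [k]. -/
/-- The number of graph homomorphisms from `F` to `G`. -/
noncomputable def homCount {α β : Type*} (F : SimpleGraph α) (G : SimpleGraph β) : ℕ :=
  Nat.card (F →g G)

/-- Restricting the target to an induced subgraph containing the image of every homomorphism
does not change the number of homomorphisms. -/
theorem homCount_induce_of_forall_mem {α β : Type*} (F : SimpleGraph α) (G : SimpleGraph β)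
    (S : Set β) (hS : ∀ (f : F →g G) (a : α), f a ∈ S) :
    homCount F (G.induce S) = homCount F G :=
  Nat.card_congr
    { toFun := fun g => (SimpleGraph.Embedding.induce S).toHom.comp g
      invFun := fun f => ⟨fun a => ⟨f a, hS f a⟩, fun h => f.map_adj h⟩
      left_inv := fun _ => rfl
      right_inv := fun _ => rfl }

/-- if some finite simple graph `G` satisfies `hom(F i, G) = m i` for every
`i`, then some finite simple graph `G'` with at most `∑ i, m i * |V(F i)|` vertices does
as well. -/
theorem stmt10 (k : ℕ) (n : Fin k → ℕ) (F : (i : Fin k) → SimpleGraph (Fin (n i)))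
    (m : Fin k → ℕ)
    (h : ∃ (V : Type) (_ : Fintype V) (G : SimpleGraph V),
      ∀ i : Fin k, homCount (F i) G = m i) :
    ∃ (V' : Type) (_ : Fintype V') (G' : SimpleGraph V'),
      Fintype.card V' ≤ ∑ i : Fin k, m i * n i ∧
      ∀ i : Fin k, homCount (F i) G' = m i := by
  obtain ⟨V, _, G, hG⟩ := h
  classical
  have : ∀ i, Finite (F i →g G) := fun i => DFunLike.finite _
  let φ : (Σ i : Fin k, (F i →g G) × Fin (n i)) → V := fun p => p.2.1 p.2.2
  refine ⟨Set.range φ, inferInstance, G.induce (Set.range φ), ?_, fun i => ?_⟩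
  · rw [← Nat.card_eq_fintype_card]
    refine (Finite.card_range_le φ).trans (le_of_eq ?_)
    simp only [Nat.card_sigma, Nat.card_prod, Nat.card_fin]
    exact Finset.sum_congr rfl fun i _ => by rw [← hG i, homCount]
  · exact (homCount_induce_of_forall_mem (F i) G _ fun f a => Set.mem_range_self (f := φ) ⟨i, f, a⟩).trans (hG i)
end

section
/- Let (d_1, …, d_n) be a non-increasing sequence of positive integers with n ≥ 2 and d_1 ≤ n − 1. Let n' := (n − 1) + (n − 1 − d_1) and let (d'_1, …, d'_{n'}) := (d_2 − 1, …, d_n − 1, 1, …, 1) with n − 1 − d_1 trailing ones. Then for every k with 2 ≤ k ≤ n, the inequality ∑_{i=1}^{k} d_i ≤ k(k−1) + ∑_{i=k+1}^{n} min(d_i, k) holds if and only if the inequality ∑_{i=1}^{k−1} d'_i ≤ (k−1)(k−2) + ∑_{i=k}^{n'} min(d'_i, k−1) holds. -/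
theorem sum_Icc_add_one {M : Type*} [AddCommMonoid M] (f : ℕ → M) (a b : ℕ) :
    ∑ i ∈ Finset.Icc a b, f (i + 1) = ∑ i ∈ Finset.Icc (a + 1) (b + 1), f i := by
  rw [← Finset.map_add_right_Icc, Finset.sum_map]
  rfl

/-- equivalence of the Erdős–Gallai inequality at index `k` for the
sequence `(d 1, …, d n)` and the inequality at index `k - 1` for the sequence
`(d' 1, …, d' n') = (d 2 - 1, …, d n - 1, 1, …, 1)` with `n - 1 - d 1` trailing ones,
where `n' = (n - 1) + (n - 1 - d 1)`. -/
theorem stmt11 (n : ℕ) (d d' : ℕ → ℕ) (hn : 2 ≤ n)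
    (hpos : ∀ i ∈ Finset.Icc 1 n, 0 < d i)
    (hmono : ∀ i j, 1 ≤ i → i ≤ j → j ≤ n → d j ≤ d i)
    (hd1 : d 1 ≤ n - 1)
    (hd'lo : ∀ i ∈ Finset.Icc 1 (n - 1), d' i = d (i + 1) - 1)
    (hd'hi : ∀ i ∈ Finset.Icc n ((n - 1) + (n - 1 - d 1)), d' i = 1)
    (k : ℕ) (hk2 : 2 ≤ k) (hkn : k ≤ n) :
    (∑ i ∈ Finset.Icc 1 k, d i
        ≤ k * (k - 1) + ∑ i ∈ Finset.Icc (k + 1) n, min (d i) k) ↔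
    (∑ i ∈ Finset.Icc 1 (k - 1), d' i
        ≤ (k - 1) * (k - 2)
          + ∑ i ∈ Finset.Icc k ((n - 1) + (n - 1 - d 1)), min (d' i) (k - 1)) := by
  obtain ⟨m, rfl⟩ : ∃ m, k = m + 1 := ⟨k - 1, by omega⟩
  obtain ⟨t, ht⟩ : ∃ t, n - 1 - d 1 = t := ⟨_, rfl⟩
  obtain ⟨p, rfl⟩ : ∃ p, n = p + 1 := ⟨n - 1, by omega⟩
  simp only [Nat.add_sub_cancel] at *
  rw [ht] at hd'hi ⊢
  have hhead : ∑ i ∈ Finset.Icc 1 (m + 1), d i = d 1 + (∑ i ∈ Finset.Icc 1 m, d' i + m) := by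
    rw [← Finset.add_sum_Ioc_eq_sum_Icc (by omega), ← Finset.Icc_add_one_left_eq_Ioc,
      ← sum_Icc_add_one]
    congr 1
    calc ∑ i ∈ Finset.Icc 1 m, d (i + 1) = ∑ i ∈ Finset.Icc 1 m, (d' i + 1) := by
          refine Finset.sum_congr rfl fun i hi => ?_
          rw [Finset.mem_Icc] at hi
          have := hpos (i + 1) (Finset.mem_Icc.2 (by omega))
          rw [hd'lo i (Finset.mem_Icc.2 (by omega))]
          omega
      _ = _ := by simp [Finset.sum_add_distrib]
  have hmid : ∑ i ∈ Finset.Icc (m + 1 + 1) (p + 1), min (d i) (m + 1)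
      = ∑ i ∈ Finset.Icc (m + 1) p, min (d' i) m + (p - m) := by
    rw [← sum_Icc_add_one]
    calc ∑ i ∈ Finset.Icc (m + 1) p, min (d (i + 1)) (m + 1)
        = ∑ i ∈ Finset.Icc (m + 1) p, (min (d' i) m + 1) := by
          refine Finset.sum_congr rfl fun i hi => ?_
          rw [Finset.mem_Icc] at hi
          have := hpos (i + 1) (Finset.mem_Icc.2 (by omega))
          rw [hd'lo i (Finset.mem_Icc.2 (by omega))]
          omega
      _ = _ := by simp [Finset.sum_add_distrib]
  have htail : ∑ i ∈ Finset.Icc (m + 1) (p + t), min (d' i) m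
      = ∑ i ∈ Finset.Icc (m + 1) p, min (d' i) m + t := by
    rw [Finset.Icc_add_one_left_eq_Ioc, Finset.Icc_add_one_left_eq_Ioc,
      ← Finset.sum_Ioc_consecutive _ (show m ≤ p by omega) (Nat.le_add_right p t)]
    congr 1
    calc ∑ i ∈ Finset.Ioc p (p + t), min (d' i) m = ∑ i ∈ Finset.Ioc p (p + t), 1 := by
          refine Finset.sum_congr rfl fun i hi => ?_
          rw [Finset.mem_Ioc] at hi
          rw [hd'hi i (Finset.mem_Icc.2 (by omega))]
          omega
      _ = t := by simp
  have hquad : (m + 1) * m = m * (m + 1 - 2) + 2 * m := by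
    obtain ⟨q, rfl⟩ : ∃ q, m = q + 1 := ⟨m - 1, by omega⟩
    simp only [show q + 1 + 1 - 2 = q by omega]
    ring
  rw [hhead, hmid, htail, hquad]
  omega
end

section
/- Let (d_1, …, d_n) be a non-increasing sequence of positive integers with n ≥ 2 and d_1 ≤ n − 1. Let n' := (n − 1) + (n − 1 − d_1) and let (d'_1, …, d'_{n'}) := (d_2 − 1, …, d_n − 1, 1, …, 1) with n − 1 − d_1 trailing ones. If ∑_{i=1}^{n} d_i ≤ n(n−1), then for every k' with n ≤ k' ≤ n' the inequality ∑_{i=1}^{k'} d'_i ≤ k'(k'−1) + ∑_{i=k'+1}^{n'} min(d'_i, k') holds. -/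
/-- if the Erdős–Gallai inequality for `(d 1, …, d n)` holds at `k = n`,
i.e. `∑_{i=1}^n d i ≤ n(n-1)`, then for every `k'` with `n ≤ k' ≤ n'` the Erdős–Gallai
inequality for the sequence `(d' 1, …, d' n') = (d 2 - 1, …, d n - 1, 1, …, 1)` (with
`n - 1 - d 1` trailing ones and `n' = (n - 1) + (n - 1 - d 1)`) holds at `k'`. -/
theorem stmt12 (n : ℕ) (d d' : ℕ → ℕ) (hn : 2 ≤ n)
    (hpos : ∀ i ∈ Finset.Icc 1 n, 0 < d i)
    (hmono : ∀ i j, 1 ≤ i → i ≤ j → j ≤ n → d j ≤ d i)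
    (hd1 : d 1 ≤ n - 1)
    (hd'lo : ∀ i ∈ Finset.Icc 1 (n - 1), d' i = d (i + 1) - 1)
    (hd'hi : ∀ i ∈ Finset.Icc n ((n - 1) + (n - 1 - d 1)), d' i = 1)
    (hEG : ∑ i ∈ Finset.Icc 1 n, d i ≤ n * (n - 1)) :
    ∀ k', n ≤ k' → k' ≤ (n - 1) + (n - 1 - d 1) →
      ∑ i ∈ Finset.Icc 1 k', d' i
        ≤ k' * (k' - 1)
          + ∑ i ∈ Finset.Icc (k' + 1) ((n - 1) + (n - 1 - d 1)), min (d' i) k' := by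
  intro k' hnk hk
  have hterm : ∀ i ∈ Finset.Icc 1 k', d' i ≤ k' - 1 := by
    intro i hi
    rw [Finset.mem_Icc] at hi
    rcases le_or_gt i (n - 1) with h | h
    · rw [hd'lo i (Finset.mem_Icc.mpr ⟨hi.1, h⟩)]
      have := hmono 1 (i + 1) le_rfl (by omega) (by omega)
      omega
    · rw [hd'hi i (Finset.mem_Icc.mpr ⟨by omega, by omega⟩)]
      omega
  have hsum := Finset.sum_le_card_nsmul _ _ _ hterm
  rw [Nat.card_Icc, Nat.add_sub_cancel, smul_eq_mul] at hsum
  exact hsum.trans (Nat.le_add_right _ _)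
end
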